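/- arXiv:2205.05647 — 2 statements merged into one kernel-verified Lean document; each statement's English description precedes it below -/
import Mathlib

section
/- Let f, g : ℝ² → ℝ be tropical signomials with N(f) ∩ N(g) finite, and let φ = f − g. Then the number of linear regions of φ, i.e. the number of connected components of ℝ² ∖ N(φ), is at most (number of connected components of ℝ² ∖ N(f)) + (number of connected components of ℝ² ∖ N(g)) + |N(f) ∩ N(g)|. -/
/-- A tropical signomial: the pointwise maximum of a nonempty finite family of affine
functions. -/
def IsTropSig {E : Type*} [AddCommGroup E] [Module ℝ E] (f : E → ℝ) : Prop :=
  ∃ (A : Finset (E →ᵃ[ℝ] ℝ)) (h : A.Nonempty), ∀ x, f x = A.sup' h (fun a => a x)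

/-- The monomial length of a tropical signomial: the minimum cardinality of a finite set of
affine functions whose pointwise maximum is `f`. -/
noncomputable def mlen {E : Type*} [AddCommGroup E] [Module ℝ E] (f : E → ℝ) : ℕ :=
  sInf {k | ∃ (A : Finset (E →ᵃ[ℝ] ℝ)) (h : A.Nonempty),
    A.card = k ∧ ∀ x, f x = A.sup' h (fun a => a x)}

/-- The factorization length of a tropical signomial: the minimum over all decompositions
`f = f₁ + ⋯ + f_m` into tropical signomials of `(Σᵢ mlen fᵢ) − (m − 1)`. -/
noncomputable def flen {E : Type*} [AddCommGroup E] [Module ℝ E] (f : E → ℝ) : ℕ :=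
  sInf {k | ∃ (m : ℕ) (_ : 0 < m) (F : Fin m → E → ℝ),
    (∀ i, IsTropSig (F i)) ∧ (∀ x, f x = ∑ i, F i x) ∧
    k = (∑ i, mlen (F i)) - (m - 1)}

/-- The non-differentiability locus of `f` (the tropical hypersurface of `f`). -/
def Ndiff {E : Type*} [NormedAddCommGroup E] [NormedSpace ℝ E] (f : E → ℝ) : Set E :=
  {x | ¬ DifferentiableAt ℝ f x}

/-- The number of regions of an arrangement `S ⊆ ℝ²`: the number of connected components of
its complement. -/
noncomputable def nregions (S : Set (ℝ × ℝ)) : ℕ :=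
  Nat.card (ConnectedComponents ↥(Sᶜ))

open Set Filter Topology

section Cells

variable {E : Type*} [NormedAddCommGroup E] [NormedSpace ℝ E]

/-- The set of points where `a` is strictly larger than every other member of `A`. -/
def cell (A : Finset (E →ᵃ[ℝ] ℝ)) (a : E →ᵃ[ℝ] ℝ) : Set E :=
  {x | ∀ a' ∈ A, a' ≠ a → a' x < a x}

/-- The set of points where the maximum of the members of `A` is attained at least twice. -/
def corner (A : Finset (E →ᵃ[ℝ] ℝ)) : Set E :=
  {x | ∃ a ∈ A, ∃ a' ∈ A, a ≠ a' ∧ a x = a' x ∧ ∀ b ∈ A, b x ≤ a x}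

/-- The directions that point from `v` into the region of `a`, if `a` is maximal at `v`. -/
def tcone (A : Finset (E →ᵃ[ℝ] ℝ)) (v : E) (a : E →ᵃ[ℝ] ℝ) : Set E :=
  {u | ∀ a' ∈ A, a' ≠ a → a' v = a v → a'.linear u < a.linear u}

variable {A : Finset (E →ᵃ[ℝ] ℝ)} {a b : E →ᵃ[ℝ] ℝ} {u v w x : E}

lemma affineMap_add (a : E →ᵃ[ℝ] ℝ) (v u : E) : a (v + u) = a v + a.linear u := by
  have := a.map_vadd v u
  simp only [vadd_eq_add] at this
  rw [add_comm, this, add_comm]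

lemma convex_cell (A : Finset (E →ᵃ[ℝ] ℝ)) (a : E →ᵃ[ℝ] ℝ) : Convex ℝ (cell A a) := by
  intro x hx y hy s t hs ht hst a' ha' hne
  have h (b : E →ᵃ[ℝ] ℝ) : b (s • x + t • y) = s * b x + t * b y := by
    simpa using Convex.combo_affine_apply (f := b) (x := x) (y := y) hst
  have h1 := hx a' ha' hne
  have h2 := hy a' ha' hne
  rw [h, h]
  rcases hs.eq_or_lt with rfl | hs
  · have : t = 1 := by linarith
    subst this; linarith
  · nlinarith [mul_lt_mul_of_pos_left h1 hs, mul_le_mul_of_nonneg_left h2.le ht]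

lemma eq_of_mem_cell (ha : a ∈ A) (hb : b ∈ A) (hxa : x ∈ cell A a) (hxb : x ∈ cell A b) :
    a = b := by
  by_contra h
  exact lt_asymm (hxa b hb (Ne.symm h)) (hxb a ha h)

lemma notMem_corner_of_mem_cell (ha : a ∈ A) (hxa : x ∈ cell A a) : x ∉ corner A := by
  rintro ⟨b, hb, b', hb', hne, heq, hmax⟩
  by_cases hba : b = a
  · subst hba
    exact (hxa b' hb' hne.symm).ne heq.symm
  · exact (hmax a ha).not_gt (hxa b hb hba)

lemma mem_cell_of_notMem_corner (ha : a ∈ A) (hmax : ∀ b ∈ A, b x ≤ a x) (hx : x ∉ corner A) :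
    x ∈ cell A a := fun b hb hne =>
  (hmax b hb).lt_of_ne fun h => hx ⟨a, ha, b, hb, hne.symm, h.symm, hmax⟩

lemma eq_of_notMem_corner (ha : a ∈ A) (hb : b ∈ A) (hamax : ∀ c ∈ A, c x ≤ a x)
    (hbmax : ∀ c ∈ A, c x ≤ b x) (hx : x ∉ corner A) : a = b :=
  eq_of_mem_cell ha hb (mem_cell_of_notMem_corner ha hamax hx)
    (mem_cell_of_notMem_corner hb hbmax hx)

lemma sub_mem_tcone (hx : x ∈ cell A a) : x - v ∈ tcone A v a := by
  intro a' ha' hne hv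
  have h := hx a' ha' hne
  rw [← add_sub_cancel v x, affineMap_add, affineMap_add, hv] at h
  linarith

lemma add_mem_tcone (hu : u ∈ tcone A v a) (hw : w ∈ tcone A v a) : u + w ∈ tcone A v a := by
  intro a' ha' hne hv
  have h1 := hu a' ha' hne hv
  have h2 := hw a' ha' hne hv
  simp only [map_add]
  linarith

lemma smul_mem_tcone {t : ℝ} (ht : 0 < t) (hu : u ∈ tcone A v a) : t • u ∈ tcone A v a := by
  intro a' ha' hne hv
  have h1 := hu a' ha' hne hv
  simp only [map_smul, smul_eq_mul]
  gcongr

lemma eq_of_mem_tcone (ha : a ∈ A) (hb : b ∈ A) (hamax : ∀ c ∈ A, c v ≤ a v)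
    (hbmax : ∀ c ∈ A, c v ≤ b v) (hua : u ∈ tcone A v a) (hub : u ∈ tcone A v b) : a = b := by
  by_contra h
  have hv := le_antisymm (hamax b hb) (hbmax a ha)
  exact lt_asymm (hua b hb (Ne.symm h) hv) (hub a ha h hv.symm)

lemma convex_tcone (A : Finset (E →ᵃ[ℝ] ℝ)) (v : E) (a : E →ᵃ[ℝ] ℝ) :
    Convex ℝ (tcone A v a) := by
  refine convex_iff_forall_pos.2 fun x hx y hy s t hs ht _ => ?_
  exact add_mem_tcone (smul_mem_tcone hs hx) (smul_mem_tcone ht hy)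

lemma add_smul_sub_mem_cell (hmax : ∀ c ∈ A, c v ≤ a v) (hx : x ∈ cell A a) {t : ℝ} (ht : 0 < t)
    (ht1 : t ≤ 1) : v + t • (x - v) ∈ cell A a := by
  intro a' ha' hne
  have h := hx a' ha' hne
  have h2 := hmax a' ha'
  rw [← add_sub_cancel v x, affineMap_add, affineMap_add] at h
  simp only [affineMap_add, map_smul, smul_eq_mul]
  nlinarith

lemma dense_affineMap_ne_zero {h : E →ᵃ[ℝ] ℝ} (hh : h ≠ 0) : Dense {x | h x ≠ 0} := by
  intro x
  by_cases hx : h x = 0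
  · obtain ⟨y, hy⟩ : ∃ y, h y ≠ 0 := by
      by_contra! H
      exact hh (AffineMap.ext H)
    have hc : Continuous fun t : ℝ => x + t • (y - x) := by fun_prop
    have ht : Tendsto (fun t : ℝ => x + t • (y - x)) (𝓝[>] 0) (𝓝 x) := by
      simpa using (hc.tendsto 0).mono_left (nhdsWithin_le_nhds (s := Ioi 0))
    refine mem_closure_of_tendsto ht ?_
    filter_upwards [self_mem_nhdsWithin] with t ht
    have e : h y = h x + h.linear (y - x) := by rw [← affineMap_add, add_sub_cancel]
    simp only [affineMap_add, map_smul, smul_eq_mul, hx, zero_add] at e ⊢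
    exact mul_ne_zero (ne_of_gt ht) (e ▸ hy)
  · exact subset_closure hx

lemma exists_mem_cell (hA : A.Nonempty) (hx : x ∉ corner A) : ∃ a ∈ A, x ∈ cell A a := by
  obtain ⟨a, ha, hmax⟩ := A.exists_max_image (fun a => a x) hA
  exact ⟨a, ha, mem_cell_of_notMem_corner ha hmax hx⟩

variable [FiniteDimensional ℝ E]

lemma isOpen_cell (A : Finset (E →ᵃ[ℝ] ℝ)) (a : E →ᵃ[ℝ] ℝ) : IsOpen (cell A a) := by
  have : cell A a = ⋂ a' ∈ A, {x | a' ≠ a → a' x < a x} := by ext; simp [cell]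
  rw [this]
  refine isOpen_biInter_finset fun a' _ => ?_
  by_cases h : a' = a
  · simp [h]
  · simpa [h] using isOpen_lt a'.continuous_of_finiteDimensional a.continuous_of_finiteDimensional

lemma isOpen_tcone (A : Finset (E →ᵃ[ℝ] ℝ)) (v : E) (a : E →ᵃ[ℝ] ℝ) : IsOpen (tcone A v a) := by
  have : tcone A v a = ⋂ a' ∈ A, {u | a' ≠ a → a' v = a v → a'.linear u < a.linear u} := by
    ext; simp [tcone]
  rw [this]
  refine isOpen_biInter_finset fun a' _ => ?_
  by_cases h : a' ≠ a ∧ a' v = a v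
  · simpa [h] using isOpen_lt a'.linear.continuous_of_finiteDimensional
      a.linear.continuous_of_finiteDimensional
  · convert isOpen_univ
    ext u
    simp only [mem_ofPred_eq, mem_univ, iff_true]
    exact fun h1 h2 => absurd ⟨h1, h2⟩ h

lemma le_of_mem_closure_cell (hx : x ∈ closure (cell A a)) : ∀ b ∈ A, b x ≤ a x := by
  intro b hb
  by_cases h : b = a
  · rw [h]
  · exact closure_minimal (fun y hy => (hy b hb h).le)
      (isClosed_le b.continuous_of_finiteDimensional a.continuous_of_finiteDimensional) hx

lemma eventually_mem_cell (hmax : ∀ c ∈ A, c v ≤ a v) (hu : u ∈ tcone A v a) :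
    ∀ᶠ t : ℝ in 𝓝[>] 0, v + t • u ∈ cell A a := by
  have : ∀ a' ∈ A, ∀ᶠ t : ℝ in 𝓝[>] 0, a' ≠ a → a' (v + t • u) < a (v + t • u) := by
    intro a' ha'
    by_cases hne : a' = a
    · simp [hne]
    rcases (hmax a' ha').eq_or_lt with hv | hv
    · filter_upwards [self_mem_nhdsWithin] with t ht _
      have h := hu a' ha' hne hv
      have ht : 0 < t := ht
      simp only [affineMap_add, map_smul, smul_eq_mul, hv]
      gcongr
    · have hc : Continuous fun t : ℝ => v + t • u := by fun_prop
      have ho := (isOpen_lt (a'.continuous_of_finiteDimensional.comp hc)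
        (a.continuous_of_finiteDimensional.comp hc)).mem_nhds (x := 0) (by simpa using hv)
      filter_upwards [nhdsWithin_le_nhds ho] with t ht _ using ht
  filter_upwards [(eventually_all_finset A).2 this] with t ht a' ha' using ht a' ha'

lemma dense_forall_affineMap_ne_zero {ι : Type*} {S : Set ι} (hS : S.Finite)
    {h : ι → E →ᵃ[ℝ] ℝ} (hh : ∀ i ∈ S, h i ≠ 0) : Dense {x | ∀ i ∈ S, h i x ≠ 0} := by
  have : {x | ∀ i ∈ S, h i x ≠ 0} = ⋂ i ∈ S, {x | h i x ≠ 0} := by ext; simp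
  rw [this]
  refine dense_biInter_of_isOpen (fun i _ => ?_) hS.countable
    fun i hi => dense_affineMap_ne_zero (hh i hi)
  exact isOpen_ne_fun (h i).continuous_of_finiteDimensional continuous_const

lemma dense_compl_corner_inter (A B : Finset (E →ᵃ[ℝ] ℝ)) :
    Dense ((corner A)ᶜ ∩ (corner B)ᶜ) := by
  classical
  refine (dense_forall_affineMap_ne_zero (E := E) (h := fun p => p.1 - p.2)
    (A.offDiag ∪ B.offDiag).finite_toSet ?_).mono ?_
  · intro p hp h
    simp only [Finset.coe_union, mem_union, Finset.mem_coe, Finset.mem_offDiag] at hp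
    have := sub_eq_zero.1 h
    tauto
  · intro x hx
    simp only [Finset.coe_union, mem_union, Finset.mem_coe, Finset.mem_offDiag] at hx
    constructor
    · rintro ⟨a, ha, a', ha', hne, h, -⟩
      exact hx (a, a') (Or.inl ⟨ha, ha', hne⟩) (by simp [h])
    · rintro ⟨a, ha, a', ha', hne, h, -⟩
      exact hx (a, a') (Or.inr ⟨ha, ha', hne⟩) (by simp [h])

lemma exists_mem_closure_cell_inter {B : Finset (E →ᵃ[ℝ] ℝ)} (hA : A.Nonempty) (hB : B.Nonempty)
    (x : E) : ∃ a ∈ A, ∃ b ∈ B, x ∈ closure (cell A a ∩ cell B b) := by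
  have h : x ∈ closure (⋃ a ∈ (A : Set _), ⋃ b ∈ (B : Set _), cell A a ∩ cell B b) := by
    refine ((dense_compl_corner_inter A B).mono ?_) x
    rintro y ⟨h1, h2⟩
    obtain ⟨a, ha, hya⟩ := exists_mem_cell hA h1
    obtain ⟨b, hb, hyb⟩ := exists_mem_cell hB h2
    simp only [mem_iUnion]
    exact ⟨a, ha, b, hb, hya, hyb⟩
  simp only [A.finite_toSet.closure_biUnion, B.finite_toSet.closure_biUnion] at h
  simpa only [mem_iUnion, exists_prop, Finset.mem_coe] using h

lemma Ndiff_eq_corner {f : E → ℝ} (hA : A.Nonempty) (hf : ∀ x, f x = A.sup' hA (fun a => a x)) :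
    Ndiff f = corner A := by
  have hle (x : E) {a} (ha : a ∈ A) : a x ≤ f x := by
    rw [hf]; exact A.le_sup' (fun a => a x) ha
  have hd (a : E →ᵃ[ℝ] ℝ) (x : E) :
      HasFDerivAt a (LinearMap.toContinuousLinearMap a.linear) x := by
    have h := (LinearMap.toContinuousLinearMap a.linear).hasFDerivAt (x := x)
    rw [a.decomp]
    exact h.add_const (a 0)
  ext x
  constructor
  · intro hx
    by_contra hc
    obtain ⟨a, ha, hmem⟩ := exists_mem_cell hA hc
    refine hx ((hd a x).differentiableAt.congr_of_eventuallyEq ?_)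
    filter_upwards [(isOpen_cell A a).mem_nhds hmem] with y hy
    rw [hf]
    refine le_antisymm (Finset.sup'_le _ _ fun b hb => ?_) (A.le_sup' (fun a => a y) ha)
    by_cases h : b = a
    · rw [h]
    · exact (hy b hb h).le
  · rintro ⟨a, ha, a', ha', hne, heq, hmax⟩ hdiff
    have hfa : f x = a x := le_antisymm (by rw [hf]; exact Finset.sup'_le _ _ hmax) (hle x ha)
    have key {b} (hb : b ∈ A) (hbx : f x = b x) :
        fderiv ℝ f x = LinearMap.toContinuousLinearMap b.linear := by
      have hmin : IsLocalMin (fun y => f y - b y) x :=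
        Eventually.of_forall fun y => by
          simp only [hbx, sub_self]
          exact sub_nonneg.2 (hle y hb)
      exact sub_eq_zero.1 (hmin.hasFDerivAt_eq_zero (hdiff.hasFDerivAt.sub (hd b x)))
    have h := (key ha hfa).symm.trans (key ha' (hfa.trans heq))
    exact hne (AffineMap.ext_linear (LinearMap.toContinuousLinearMap.injective h) heq)

end Cells

section Components

lemma card_nregions_of_mem_closure {ι : Type*} [Finite ι] {S : Set (ℝ × ℝ)} {C : ι → Set (ℝ × ℝ)}
    (hne : ∀ i, (C i).Nonempty) (hC : ∀ i, IsPreconnected (C i)) (hS : ∀ i, C i ⊆ Sᶜ)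
    (hcl : ∀ x ∈ Sᶜ, ∃ i, x ∈ closure (C i)) :
    Finite (ConnectedComponents ↥(Sᶜ)) ∧ nregions S ≤ Nat.card ι := by
  choose p hp using hne
  have hsurj : Function.Surjective
      (fun i => (ConnectedComponents.mk ⟨p i, hS i (hp i)⟩ : ConnectedComponents ↥(Sᶜ))) := by
    rintro ⟨x, hx⟩
    obtain ⟨i, hi⟩ := hcl x hx
    refine ⟨i, ConnectedComponents.coe_eq_coe'.2 ?_⟩
    have hpre : IsPreconnected ((↑) ⁻¹' insert x (C i) : Set ↥(Sᶜ)) := by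
      rw [← Topology.IsInducing.subtypeVal.isPreconnected_image,
        Subtype.image_preimage_coe, inter_eq_right.2 (insert_subset hx (hS i))]
      exact (hC i).subset_closure (subset_insert _ _) (insert_subset hi subset_closure)
    have hmem : (⟨p i, hS i (hp i)⟩ : ↥(Sᶜ)) ∈ ((↑) ⁻¹' insert x (C i) : Set ↥(Sᶜ)) :=
      mem_insert_of_mem x (hp i)
    exact hpre.subset_connectedComponent (x := ⟨x, hx⟩) (mem_insert x (C i)) hmem
  exact ⟨Finite.of_surjective _ hsurj, Nat.card_le_card_of_surjective _ hsurj⟩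

lemma card_le_nregions {ι : Type*} [Finite ι] {S : Set (ℝ × ℝ)} {C : ι → Set (ℝ × ℝ)}
    (hne : ∀ i, (C i).Nonempty) (hC : ∀ i, IsPreconnected (C i)) (ho : ∀ i, IsOpen (C i))
    (hdisj : Pairwise (Function.onFun Disjoint C)) (hS : Sᶜ = ⋃ i, C i) :
    Nat.card ι ≤ nregions S := by
  have hsub (i : ι) : C i ⊆ Sᶜ := hS ▸ subset_iUnion C i
  have := (card_nregions_of_mem_closure hne hC hsub fun x hx => by
    rw [hS, mem_iUnion] at hx
    exact hx.imp fun i hi => subset_closure hi).1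
  choose p hp using hne
  refine Nat.card_le_card_of_injective
    (fun i => (ConnectedComponents.mk ⟨p i, hsub i (hp i)⟩ : ConnectedComponents ↥(Sᶜ))) ?_
  intro i j hij
  have hclopen : IsClopen ((↑) ⁻¹' C j : Set ↥(Sᶜ)) := by
    refine ⟨?_, (ho j).preimage continuous_subtype_val⟩
    have : ((↑) ⁻¹' C j : Set ↥(Sᶜ)) = ((↑) ⁻¹' (⋃ k ∈ {k | k ≠ j}, C k))ᶜ := by
      ext ⟨x, hx⟩
      simp only [mem_preimage, mem_compl_iff, mem_iUnion, not_exists, mem_ofPred_eq]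
      refine ⟨fun h k hk hxk => disjoint_left.1 (hdisj hk) hxk h, fun h => ?_⟩
      rw [hS, mem_iUnion] at hx
      obtain ⟨k, hk⟩ := hx
      by_cases hkj : k = j
      · exact hkj ▸ hk
      · exact absurd hk (h k hkj)
    rw [this]
    exact ((isOpen_biUnion fun k _ => ho k).preimage continuous_subtype_val).isClosed_compl
  have hi := hclopen.connectedComponent_subset (x := ⟨p j, hsub j (hp j)⟩) (hp j)
    (ConnectedComponents.coe_eq_coe'.1 hij)
  by_contra h
  exact disjoint_left.1 (hdisj h) (hp i) hi

end Components

section Intervals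

variable {I J : Set ℝ}

/-- The sets `I` and `J` overlap immediately to the right of a point that bounds `I` from below. -/
def LeftEnd (I J : Set ℝ) : Prop :=
  ∃ s z, s < z ∧ Ioo s z ⊆ I ∩ J ∧ ∀ x ∈ I, s ≤ x

lemma leftEnd_or_leftEnd (hIo : IsOpen I) (hJo : IsOpen J) (hI : I.OrdConnected)
    (hJ : J.OrdConnected) (hne : (I ∩ J).Nonempty) (hb : BddBelow (I ∩ J)) :
    LeftEnd I J ∨ LeftEnd J I := by
  obtain ⟨z, hz⟩ := hne
  have hle : ∀ x ∈ I ∩ J, sInf (I ∩ J) ≤ x := fun x hx => csInf_le hb hx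
  have hnot : sInf (I ∩ J) ∉ I ∩ J := by
    intro h
    obtain ⟨l, hl, hsub⟩ := exists_Ioc_subset_of_mem_nhds ((hIo.inter hJo).mem_nhds h)
      (exists_lt _)
    obtain ⟨m, hm1, hm2⟩ := exists_between hl
    exact (hle m (hsub ⟨hm1, hm2.le⟩)).not_gt hm2
  have hlt : sInf (I ∩ J) < z := (hle z hz).lt_of_ne fun h => hnot (h ▸ hz)
  have hsub : Ioo (sInf (I ∩ J)) z ⊆ I ∩ J := by
    intro y hy
    obtain ⟨x, hx, hxy⟩ := exists_lt_of_csInf_lt ⟨z, hz⟩ hy.1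
    exact (hI.inter hJ).out hx hz ⟨hxy.le, hy.2.le⟩
  by_contra! h
  obtain ⟨h1, h2⟩ := h
  simp only [LeftEnd, not_exists, not_and, not_forall, not_le] at h1 h2
  obtain ⟨x, hx, hxs⟩ := h1 _ _ hlt hsub
  obtain ⟨y, hy, hys⟩ := h2 _ _ hlt (inter_comm I J ▸ hsub)
  have hmz : max x y ≤ z := (max_lt hxs hys).le.trans hlt.le
  have hmem : max x y ∈ I ∩ J :=
    ⟨hI.out hx hz.1 ⟨le_max_left _ _, hmz⟩, hJ.out hy hz.2 ⟨le_max_right _ _, hmz⟩⟩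
  exact (hle _ hmem).not_gt (max_lt hxs hys)

lemma LeftEnd.inter_nonempty {J' : Set ℝ} (h : LeftEnd I J) (h' : LeftEnd I J') :
    (J ∩ J').Nonempty := by
  obtain ⟨s, z, hsz, hsub, hle⟩ := h
  obtain ⟨s', z', hsz', hsub', hle'⟩ := h'
  have h1 : s' ≤ s := le_of_forall_gt_imp_ge_of_dense fun x hx => by
    obtain ⟨y, hy1, hy2⟩ := exists_between (lt_min hx hsz)
    exact (hle' y (hsub ⟨hy1, hy2.trans_le (min_le_right _ _)⟩).1).trans
      (hy2.le.trans (min_le_left _ _))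
  have h2 : s ≤ s' := le_of_forall_gt_imp_ge_of_dense fun x hx => by
    obtain ⟨y, hy1, hy2⟩ := exists_between (lt_min hx hsz')
    exact (hle y (hsub' ⟨hy1, hy2.trans_le (min_le_right _ _)⟩).1).trans
      (hy2.le.trans (min_le_left _ _))
  obtain rfl := le_antisymm h1 h2
  obtain ⟨y, hy1, hy2⟩ := exists_between (lt_min hsz hsz')
  exact ⟨y, (hsub ⟨hy1, hy2.trans_le (min_le_left _ _)⟩).2,
    (hsub' ⟨hy1, hy2.trans_le (min_le_right _ _)⟩).2⟩

lemma LeftEnd.exists_Ioi_subset (h : LeftEnd I J) (hI : I.OrdConnected) (hb : ¬ BddAbove I) :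
    ∃ s z, s < z ∧ Ioo s z ⊆ J ∧ Ioi s ⊆ I := by
  obtain ⟨s, z, hsz, hsub, -⟩ := h
  refine ⟨s, z, hsz, fun y hy => (hsub hy).2, fun x hx => ?_⟩
  obtain ⟨y, hy1, hy2⟩ := exists_between (lt_min hx hsz)
  obtain ⟨w, hw, hxw⟩ := not_bddAbove_iff.1 hb x
  exact hI.out (hsub ⟨hy1, hy2.trans_le (min_le_right _ _)⟩).1 hw
    ⟨hy2.le.trans (min_le_left _ _), hxw.le⟩

end Intervals

section Plane

/-- The Euclidean inner product on `ℝ × ℝ`. -/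
def dot (u w : ℝ × ℝ) : ℝ := u.1 * w.1 + u.2 * w.2

/-- The rotation of the plane by a right angle. -/
def rot : ℝ × ℝ →ₗ[ℝ] ℝ × ℝ := LinearMap.prod (-LinearMap.snd ℝ ℝ ℝ) (LinearMap.fst ℝ ℝ ℝ)

@[simp] lemma rot_apply (u : ℝ × ℝ) : rot u = (-u.2, u.1) := rfl

lemma dot_self_pos {u : ℝ × ℝ} (hu : u ≠ 0) : 0 < dot u u := by
  by_contra! h
  simp only [dot] at h
  refine hu (Prod.ext ?_ ?_) <;> simp only [Prod.fst_zero, Prod.snd_zero] <;> nlinarith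

lemma continuous_dot_left (w : ℝ × ℝ) : Continuous fun u => dot u w := by
  unfold dot; fun_prop

/-- A characterization of the Euclidean projection of `c` to the closure of a convex set `C`. -/
def IsApex (c : ℝ × ℝ) (C : Set (ℝ × ℝ)) (v : ℝ × ℝ) : Prop :=
  v ∈ closure C ∧ ∀ y ∈ C, 0 ≤ dot (y - v) (v - c)

variable {c v v' : ℝ × ℝ} {C : Set (ℝ × ℝ)}

lemma exists_add_smul_mem (ho : IsOpen C) {y : ℝ × ℝ} (hy : y ∈ C) (w : ℝ × ℝ) :
    ∃ t ∈ Ioc (0 : ℝ) 1, y + t • w ∈ C := by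
  have hc : Continuous fun t : ℝ => y + t • w := by fun_prop
  have hev : ∀ᶠ t in 𝓝[>] (0 : ℝ), y + t • w ∈ C :=
    nhdsWithin_le_nhds ((ho.preimage hc).mem_nhds (by simpa using hy))
  exact ((Filter.eventually_mem_set.2 (Ioc_mem_nhdsGT (zero_lt_one' ℝ))).and hev).exists

lemma IsApex.nonneg_of_mem_closure (h : IsApex c C v) {y : ℝ × ℝ} (hy : y ∈ closure C) :
    0 ≤ dot (y - v) (v - c) :=
  closure_minimal h.2 (isClosed_le continuous_const
    ((continuous_dot_left (v - c)).comp (continuous_id.sub continuous_const))) hy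

lemma IsApex.unique (h : IsApex c C v) (h' : IsApex c C v') : v = v' := by
  have h1 := h.nonneg_of_mem_closure h'.1
  have h2 := h'.nonneg_of_mem_closure h.1
  by_contra hne
  have h3 := dot_self_pos (sub_ne_zero.2 hne)
  simp only [dot, Prod.fst_sub, Prod.snd_sub] at h1 h2 h3
  nlinarith

lemma IsApex.dot_pos (h : IsApex c C v) (ho : IsOpen C) (hne : v ≠ c) {y : ℝ × ℝ} (hy : y ∈ C) :
    0 < dot (y - v) (v - c) := by
  obtain ⟨t, ⟨ht0, -⟩, ht⟩ := exists_add_smul_mem ho hy (-(v - c))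
  have h1 := h.2 _ ht
  have h2 := mul_pos ht0 (dot_self_pos (sub_ne_zero.2 hne))
  simp only [dot, Prod.fst_sub, Prod.snd_sub, Prod.smul_fst, Prod.smul_snd, smul_eq_mul,
    Prod.fst_add, Prod.snd_add, Prod.fst_neg, Prod.snd_neg] at *
  nlinarith

lemma exists_isApex (c : ℝ × ℝ) (hC : Convex ℝ C) (hne : C.Nonempty) : ∃ v, IsApex c C v := by
  obtain ⟨x, hx⟩ := hne
  have hq : Continuous fun y : ℝ × ℝ => dot (y - c) (y - c) := by unfold dot; fun_prop
  have hclosed : IsClosed (closure C ∩ {y | dot (y - c) (y - c) ≤ dot (x - c) (x - c)}) :=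
    isClosed_closure.inter (isClosed_le hq continuous_const)
  have hcomp : IsCompact (closure C ∩ {y | dot (y - c) (y - c) ≤ dot (x - c) (x - c)}) := by
    refine Metric.isCompact_of_isClosed_isBounded hclosed
      ((Metric.isBounded_closedBall (x := c) (r := dot (x - c) (x - c) + 1)).subset ?_)
    rintro y ⟨-, hy⟩
    simp only [mem_ofPred_eq, dot, Prod.fst_sub, Prod.snd_sub] at hy ⊢
    rw [Metric.mem_closedBall, Prod.dist_eq, Real.dist_eq, Real.dist_eq]
    refine max_le (abs_le_of_sq_le_sq ?_ ?_) (abs_le_of_sq_le_sq ?_ ?_) <;>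
      nlinarith [sq_nonneg (y.1 - c.1), sq_nonneg (y.2 - c.2), sq_nonneg (x.1 - c.1),
        sq_nonneg (x.2 - c.2)]
  obtain ⟨v, hv, hmin⟩ := hcomp.exists_isMinOn
    ⟨x, subset_closure hx, le_refl (dot (x - c) (x - c))⟩ hq.continuousOn
  refine ⟨v, hv.1, fun y hy => ?_⟩
  have key (t : ℝ) (h0 : 0 ≤ t) (h1 : t ≤ 1) :
      dot (v - c) (v - c) ≤ dot (v + t • (y - v) - c) (v + t • (y - v) - c) := by
    rcases le_total (dot (v + t • (y - v) - c) (v + t • (y - v) - c)) (dot (x - c) (x - c))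
      with h | h
    · exact hmin ⟨hC.closure.add_smul_sub_mem hv.1 (subset_closure hy) ⟨h0, h1⟩, h⟩
    · exact (mem_ofPred_eq ▸ hv.2).trans h
  have hexp (t : ℝ) : dot (v + t • (y - v) - c) (v + t • (y - v) - c) =
      dot (v - c) (v - c) + t * (2 * dot (y - v) (v - c) + t * dot (y - v) (y - v)) := by
    simp only [dot, Prod.fst_sub, Prod.snd_sub, Prod.smul_fst, Prod.smul_snd, smul_eq_mul,
      Prod.fst_add, Prod.snd_add]
    ring
  have hnn (t : ℝ) (h0 : 0 < t) (h1 : t ≤ 1) :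
      0 ≤ 2 * dot (y - v) (v - c) + t * dot (y - v) (y - v) := by
    have h := key t h0.le h1
    rw [hexp] at h
    exact nonneg_of_mul_nonneg_right (by linarith) h0
  have hlim : Tendsto (fun t : ℝ => 2 * dot (y - v) (v - c) + t * dot (y - v) (y - v))
      (𝓝[>] 0) (𝓝 (2 * dot (y - v) (v - c))) := by
    have hcont : Continuous fun t : ℝ =>
      2 * dot (y - v) (v - c) + t * dot (y - v) (y - v) := by fun_prop
    simpa using (hcont.tendsto 0).mono_left (nhdsWithin_le_nhds (s := Ioi 0))
  have := ge_of_tendsto hlim (by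
    filter_upwards [Ioc_mem_nhdsGT (zero_lt_one' ℝ)] with t ht using hnn t ht.1 ht.2)
  linarith

end Plane

section Slices

variable {A B : Finset (ℝ × ℝ →ᵃ[ℝ] ℝ)} {a a' b b' : ℝ × ℝ →ᵃ[ℝ] ℝ} {c e v : ℝ × ℝ}

/-- The directions from `v` into the region of `a`, on the line through `e` orthogonal to `e`. -/
def slice (A : Finset (ℝ × ℝ →ᵃ[ℝ] ℝ)) (v e : ℝ × ℝ) (a : ℝ × ℝ →ᵃ[ℝ] ℝ) : Set ℝ :=
  {s | e + s • rot e ∈ tcone A v a}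

lemma isOpen_slice (A : Finset (ℝ × ℝ →ᵃ[ℝ] ℝ)) (v e : ℝ × ℝ) (a : ℝ × ℝ →ᵃ[ℝ] ℝ) :
    IsOpen (slice A v e a) :=
  (isOpen_tcone A v a).preimage (by fun_prop : Continuous fun s : ℝ => e + s • rot e)

lemma ordConnected_slice (A : Finset (ℝ × ℝ →ᵃ[ℝ] ℝ)) (v e : ℝ × ℝ) (a : ℝ × ℝ →ᵃ[ℝ] ℝ) :
    (slice A v e a).OrdConnected := by
  have h := (convex_tcone A v a).affine_preimage (AffineMap.lineMap e (e + rot e) : ℝ →ᵃ[ℝ] ℝ × ℝ)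
  have : slice A v e a = (AffineMap.lineMap e (e + rot e) : ℝ →ᵃ[ℝ] ℝ × ℝ) ⁻¹' tcone A v a := by
    ext s
    simp [slice, AffineMap.lineMap_apply, add_comm]
  exact this ▸ h.ordConnected

lemma mem_tcone_of_unbounded {w : ℝ × ℝ}
    (hgen : ∀ a' ∈ A, a' ≠ a → a' v = a v → a'.linear w ≠ a.linear w)
    (h : ∀ N : ℝ, ∃ r > N, e + r • w ∈ tcone A v a) : w ∈ tcone A v a := by
  intro a' ha' hne hv
  refine lt_of_le_of_ne (le_of_not_gt fun hlt => ?_) (hgen a' ha' hne hv)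
  obtain ⟨r, hr, hmem⟩ := h ((a.linear e - a'.linear e) / (a'.linear w - a.linear w))
  have h1 := hmem a' ha' hne hv
  rw [gt_iff_lt, div_lt_iff₀ (by linarith)] at hr
  simp only [map_add, map_smul, smul_eq_mul] at h1
  linarith

lemma IsApex.notMem_tcone_or {w : ℝ × ℝ} (h : IsApex c (cell A a ∩ cell B b) v) (hvc : v ≠ c)
    (hw : dot w (v - c) = 0) : w ∉ tcone A v a ∨ w ∉ tcone B v b := by
  by_contra! hmem
  have ha := le_of_mem_closure_cell (closure_mono inter_subset_left h.1)
  have hb := le_of_mem_closure_cell (closure_mono inter_subset_right h.1)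
  obtain ⟨t, hta, htb⟩ :=
    ((eventually_mem_cell ha hmem.1).and (eventually_mem_cell hb hmem.2)).exists
  have := h.dot_pos ((isOpen_cell A a).inter (isOpen_cell B b)) hvc ⟨hta, htb⟩
  simp only [dot, Prod.fst_sub, Prod.snd_sub, Prod.smul_fst, Prod.smul_snd, smul_eq_mul,
    Prod.fst_add, Prod.snd_add] at hw this
  have h0 : t * (w.1 * (v.1 - c.1) + w.2 * (v.2 - c.2)) = 0 := by rw [hw, mul_zero]
  nlinarith

/-- No two members of `A` that agree at `v` have the same slope orthogonally to `v - c`. -/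
def GenericAt (A : Finset (ℝ × ℝ →ᵃ[ℝ] ℝ)) (c v : ℝ × ℝ) : Prop :=
  ∀ a ∈ A, ∀ a' ∈ A, a' ≠ a → a' v = a v → a'.linear (rot (v - c)) ≠ a.linear (rot (v - c))

lemma IsApex.bddAbove_slice (h : IsApex c (cell A a ∩ cell B b) v) (hvc : v ≠ c) (ha : a ∈ A)
    (hb : b ∈ B) (hgA : GenericAt A c v) (hgB : GenericAt B c v) :
    BddAbove (slice A v (v - c) a ∩ slice B v (v - c) b) := by
  by_contra hbdd
  have hu := not_bddAbove_iff.1 hbdd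
  have hA : rot (v - c) ∈ tcone A v a := mem_tcone_of_unbounded (e := v - c) (hgA a ha) fun N => by
    obtain ⟨r, hr, hN⟩ := hu N
    exact ⟨r, hN, hr.1⟩
  have hB : rot (v - c) ∈ tcone B v b := mem_tcone_of_unbounded (e := v - c) (hgB b hb) fun N => by
    obtain ⟨r, hr, hN⟩ := hu N
    exact ⟨r, hN, hr.2⟩
  have := h.notMem_tcone_or (w := rot (v - c)) hvc (by simp [dot]; ring)
  tauto

lemma IsApex.bddBelow_slice (h : IsApex c (cell A a ∩ cell B b) v) (hvc : v ≠ c) (ha : a ∈ A)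
    (hb : b ∈ B) (hgA : GenericAt A c v) (hgB : GenericAt B c v) :
    BddBelow (slice A v (v - c) a ∩ slice B v (v - c) b) := by
  by_contra hbdd
  have hu := not_bddBelow_iff.1 hbdd
  have hA : -rot (v - c) ∈ tcone A v a :=
    mem_tcone_of_unbounded (e := v - c) (fun a' ha' hne hv => by
      simpa only [map_neg, ne_eq, neg_inj] using hgA a ha a' ha' hne hv) fun N => by
    obtain ⟨r, hr, hN⟩ := hu (-N)
    exact ⟨-r, by linarith, by rw [neg_smul_neg]; exact hr.1⟩
  have hB : -rot (v - c) ∈ tcone B v b :=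
    mem_tcone_of_unbounded (e := v - c) (fun b' hb' hne hv => by
      simpa only [map_neg, ne_eq, neg_inj] using hgB b hb b' hb' hne hv) fun N => by
    obtain ⟨r, hr, hN⟩ := hu (-N)
    exact ⟨-r, by linarith, by rw [neg_smul_neg]; exact hr.2⟩
  have := h.notMem_tcone_or (w := -rot (v - c)) hvc (by simp [dot]; ring)
  tauto

lemma dot_self_smul (u e : ℝ × ℝ) : dot e e • u = dot u e • e + dot u (rot e) • rot e := by
  ext <;> simp [dot] <;> ring

lemma IsApex.slice_inter_nonempty (h : IsApex c (cell A a ∩ cell B b) v) (hvc : v ≠ c) :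
    (slice A v (v - c) a ∩ slice B v (v - c) b).Nonempty := by
  obtain ⟨y, hy⟩ := closure_nonempty_iff.1 ⟨v, h.1⟩
  have hpos := h.dot_pos ((isOpen_cell A a).inter (isOpen_cell B b)) hvc hy
  have hD := dot_self_pos (sub_ne_zero.2 hvc)
  have hline : (dot (y - v) (v - c))⁻¹ • dot (v - c) (v - c) • (y - v) =
      (v - c) + ((dot (y - v) (v - c))⁻¹ * dot (y - v) (rot (v - c))) • rot (v - c) := by
    rw [dot_self_smul, smul_add, inv_smul_smul₀ hpos.ne', mul_smul]
  refine ⟨(dot (y - v) (v - c))⁻¹ * dot (y - v) (rot (v - c)), ?_, ?_⟩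
  · change _ ∈ tcone A v a
    rw [← hline]
    exact smul_mem_tcone (inv_pos.2 hpos) (smul_mem_tcone hD (sub_mem_tcone hy.1))
  · change _ ∈ tcone B v b
    rw [← hline]
    exact smul_mem_tcone (inv_pos.2 hpos) (smul_mem_tcone hD (sub_mem_tcone hy.2))

lemma isApex_cell_of_bdd_slice (hmax : ∀ c ∈ A, c v ≤ a v) (hvc : v ≠ c)
    (hne : (slice A v (v - c) a).Nonempty) (hA : BddAbove (slice A v (v - c) a))
    (hB : BddBelow (slice A v (v - c) a)) : IsApex c (cell A a) v := by
  obtain ⟨s, hs⟩ := hne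
  constructor
  · have hc : Continuous fun t : ℝ => v + t • ((v - c) + s • rot (v - c)) := by fun_prop
    have ht : Tendsto (fun t : ℝ => v + t • ((v - c) + s • rot (v - c))) (𝓝[>] 0) (𝓝 v) := by
      simpa using (hc.tendsto 0).mono_left (nhdsWithin_le_nhds (s := Ioi 0))
    exact mem_closure_of_tendsto ht (eventually_mem_cell hmax hs)
  · intro y hy
    by_contra! hneg
    obtain ⟨κ, hκ⟩ : ∃ κ : ℝ, κ • rot (v - c) ∈ tcone A v a := by
      refine ⟨dot (y - v) (rot (v - c)) - dot (y - v) (v - c) * s, ?_⟩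
      have h := add_mem_tcone
        (smul_mem_tcone (dot_self_pos (sub_ne_zero.2 hvc)) (sub_mem_tcone hy (v := v)))
        (smul_mem_tcone (neg_pos.2 hneg) hs)
      rw [dot_self_smul] at h
      convert h using 1
      module
    have hray (r : ℝ) (hr : 0 < r) : s + r * κ ∈ slice A v (v - c) a := by
      change _ ∈ tcone A v a
      convert add_mem_tcone hs (smul_mem_tcone hr hκ) using 1
      module
    rcases lt_trichotomy κ 0 with hk | rfl | hk
    · obtain ⟨m, hm⟩ := hB
      have h := hm (hray ((|s - m| + 1) / -κ) (div_pos (by positivity) (by linarith)))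
      have e : (|s - m| + 1) / -κ * κ = -(|s - m| + 1) := by
        rw [div_neg, neg_mul, div_mul_cancel₀ _ hk.ne]
      rw [e] at h
      linarith [le_abs_self (s - m)]
    · obtain ⟨m, hm⟩ := hA
      have h : m + 1 ∈ slice A v (v - c) a := by
        intro a' ha' hne hv
        simpa using hκ a' ha' hne hv
      linarith [hm h]
    · obtain ⟨m, hm⟩ := hA
      have h := hm (hray ((|m - s| + 1) / κ) (by positivity))
      rw [div_mul_cancel₀ _ hk.ne'] at h
      linarith [le_abs_self (m - s)]

lemma IsApex.cell_of_notMem_corner (h : IsApex c (cell A a ∩ cell B b) v) (hb : b ∈ B)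
    (hv : v ∉ corner B) : IsApex c (cell A a) v := by
  have hva := closure_mono inter_subset_left h.1
  refine ⟨hva, fun y hy => ?_⟩
  have hvb : v ∈ cell B b := mem_cell_of_notMem_corner hb
    (le_of_mem_closure_cell (closure_mono inter_subset_right h.1)) hv
  obtain ⟨t, ht, htB⟩ := exists_add_smul_mem (isOpen_cell B b) hvb (y - v)
  have h1 := h.2 _ ⟨add_smul_sub_mem_cell (le_of_mem_closure_cell hva) hy ht.1 ht.2, htB⟩
  refine nonneg_of_mul_nonneg_right (a := t) ?_ ht.1
  simp only [dot, Prod.fst_sub, Prod.snd_sub, Prod.smul_fst, Prod.smul_snd, smul_eq_mul,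
    Prod.fst_add, Prod.snd_add] at h1 ⊢
  linarith

end Slices

section Counting

variable {A B : Finset (ℝ × ℝ →ᵃ[ℝ] ℝ)} {a a' b b' : ℝ × ℝ →ᵃ[ℝ] ℝ} {c v : ℝ × ℝ}

/-- The region of `a` and its overlap with the region of `b` have a common apex, from which the
overlap can be recovered. -/
def SharesApex (c : ℝ × ℝ) (A B : Finset (ℝ × ℝ →ᵃ[ℝ] ℝ)) (a b : ℝ × ℝ →ᵃ[ℝ] ℝ) : Prop :=
  ∃ v, IsApex c (cell A a) v ∧ IsApex c (cell A a ∩ cell B b) v ∧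
    (v ∉ corner B ∨ LeftEnd (slice A v (v - c) a) (slice B v (v - c) b))

/-- The region of `a` and its overlap with the region of `b` have the same left edge at the apex
`v` of the overlap, but the region of `a` is unbounded to the right. -/
def IsLastAt (c : ℝ × ℝ) (A B : Finset (ℝ × ℝ →ᵃ[ℝ] ℝ)) (a b : ℝ × ℝ →ᵃ[ℝ] ℝ) (v : ℝ × ℝ) :
    Prop :=
  IsApex c (cell A a ∩ cell B b) v ∧
    BddAbove (slice A v (v - c) a ∩ slice B v (v - c) b) ∧
    LeftEnd (slice A v (v - c) a) (slice B v (v - c) b) ∧ ¬ BddAbove (slice A v (v - c) a)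

lemma IsApex.le_left (h : IsApex c (cell A a ∩ cell B b) v) : ∀ d ∈ A, d v ≤ a v :=
  le_of_mem_closure_cell (closure_mono inter_subset_left h.1)

lemma IsApex.le_right (h : IsApex c (cell A a ∩ cell B b) v) : ∀ d ∈ B, d v ≤ b v :=
  le_of_mem_closure_cell (closure_mono inter_subset_right h.1)

lemma SharesApex.unique (hb : b ∈ B) (hb' : b' ∈ B) (h : SharesApex c A B a b)
    (h' : SharesApex c A B a b') : b = b' := by
  obtain ⟨v, hav, hv, hor⟩ := h
  obtain ⟨v', hav', hv', hor'⟩ := h'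
  obtain rfl := hav.unique hav'
  by_cases hc : v ∈ corner B
  · obtain ⟨s, hs, hs'⟩ :=
      (hor.resolve_left (not_not.2 hc)).inter_nonempty (hor'.resolve_left (not_not.2 hc))
    exact eq_of_mem_tcone hb hb' hv.le_right hv'.le_right hs hs'
  · exact eq_of_notMem_corner hb hb' hv.le_right hv'.le_right hc

lemma IsLastAt.unique (ha : a ∈ A) (ha' : a' ∈ A) (hb : b ∈ B) (hb' : b' ∈ B)
    (h : IsLastAt c A B a b v) (h' : IsLastAt c A B a' b' v) : a = a' ∧ b = b' := by
  obtain ⟨hv, -, hl, hu⟩ := h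
  obtain ⟨hv', -, hl', hu'⟩ := h'
  obtain ⟨s, -, -, -, hs⟩ := hl.exists_Ioi_subset (ordConnected_slice _ _ _ _) hu
  obtain ⟨s', -, -, -, hs'⟩ := hl'.exists_Ioi_subset (ordConnected_slice _ _ _ _) hu'
  obtain ⟨x, hx⟩ := exists_gt (max s s')
  obtain rfl := eq_of_mem_tcone ha ha' hv.le_left hv'.le_left
    (hs ((le_max_left _ _).trans_lt hx)) (hs' ((le_max_right _ _).trans_lt hx))
  obtain ⟨x, hx, hx'⟩ := hl.inter_nonempty hl'
  exact ⟨rfl, eq_of_mem_tcone hb hb' hv.le_right hv'.le_right hx hx'⟩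

lemma IsLastAt.not_isLastAt_swap (ha : a ∈ A) (ha' : a' ∈ A) (hb : b ∈ B) (hb' : b' ∈ B)
    (h : IsLastAt c A B a b v) : ¬ IsLastAt c B A b' a' v := by
  rintro ⟨hv', hbd', hl', hu'⟩
  obtain ⟨hv, hbd, hl, hu⟩ := h
  obtain ⟨s, z, hsz, hz, hs⟩ := hl.exists_Ioi_subset (ordConnected_slice _ _ _ _) hu
  obtain ⟨s', z', hsz', hz', hs'⟩ := hl'.exists_Ioi_subset (ordConnected_slice _ _ _ _) hu'
  have hunb : ¬ BddAbove (slice A v (v - c) a ∩ slice B v (v - c) b') := fun hB =>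
    not_bddAbove_Ioi (max s s') (hB.mono (subset_inter
      ((Ioi_subset_Ioi (le_max_left _ _)).trans hs) ((Ioi_subset_Ioi (le_max_right _ _)).trans hs')))
  rcases le_or_gt s s' with hss | hss
  · obtain ⟨x, hx⟩ : ∃ x, x ∈ Ioo s' z' := exists_between hsz'
    obtain rfl := eq_of_mem_tcone ha ha' hv.le_left hv'.le_right (hs (hss.trans_lt hx.1)) (hz' hx)
    exact hunb (inter_comm _ _ ▸ hbd')
  · obtain ⟨x, hx⟩ : ∃ x, x ∈ Ioo s z := exists_between hsz
    obtain rfl := eq_of_mem_tcone hb hb' hv.le_right hv'.le_left (hz hx) (hs' (hss.trans hx.1))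
    exact hunb hbd

lemma sharesApex_or_isLastAt (ha : a ∈ A) (hb : b ∈ B)
    (hgen : ∀ v ∈ corner A ∩ corner B, v ≠ c ∧ GenericAt A c v ∧ GenericAt B c v)
    (hne : (cell A a ∩ cell B b).Nonempty) :
    SharesApex c A B a b ∨ SharesApex c B A b a ∨
      ∃ v ∈ corner A ∩ corner B, IsLastAt c A B a b v ∨ IsLastAt c B A b a v := by
  obtain ⟨v, hv⟩ := exists_isApex c ((convex_cell A a).inter (convex_cell B b)) hne
  have hv' : IsApex c (cell B b ∩ cell A a) v := inter_comm (cell A a) _ ▸ hv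
  by_cases hvB : v ∈ corner B
  swap
  · exact Or.inl ⟨v, hv.cell_of_notMem_corner hb hvB, hv, Or.inl hvB⟩
  by_cases hvA : v ∈ corner A
  swap
  · exact Or.inr (Or.inl ⟨v, hv'.cell_of_notMem_corner ha hvA, hv', Or.inl hvA⟩)
  obtain ⟨hvc, hgA, hgB⟩ := hgen v ⟨hvA, hvB⟩
  have hslice := hv.slice_inter_nonempty hvc
  have hbdd := hv.bddAbove_slice hvc ha hb hgA hgB
  rcases leftEnd_or_leftEnd (isOpen_slice _ _ _ _) (isOpen_slice _ _ _ _)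
    (ordConnected_slice _ _ _ _) (ordConnected_slice _ _ _ _) hslice
    (hv.bddBelow_slice hvc ha hb hgA hgB) with hl | hl
  · by_cases hu : BddAbove (slice A v (v - c) a)
    · have hlow : BddBelow (slice A v (v - c) a) := let ⟨s, _, _, _, hs⟩ := hl; ⟨s, hs⟩
      exact Or.inl ⟨v, isApex_cell_of_bdd_slice hv.le_left hvc (hslice.mono inter_subset_left)
        hu hlow, hv, Or.inr hl⟩
    · exact Or.inr (Or.inr ⟨v, ⟨hvA, hvB⟩, Or.inl ⟨hv, hbdd, hl, hu⟩⟩)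
  · by_cases hu : BddAbove (slice B v (v - c) b)
    · have hlow : BddBelow (slice B v (v - c) b) := let ⟨s, _, _, _, hs⟩ := hl; ⟨s, hs⟩
      exact Or.inr (Or.inl ⟨v, isApex_cell_of_bdd_slice hv.le_right hvc
        (hslice.mono inter_subset_right) hu hlow, hv', Or.inr hl⟩)
    · exact Or.inr (Or.inr ⟨v, ⟨hvA, hvB⟩, Or.inr ⟨hv', inter_comm _ _ ▸ hbdd, hl, hu⟩⟩)

lemma exists_genericAt (A : Finset (ℝ × ℝ →ᵃ[ℝ] ℝ)) {S : Set (ℝ × ℝ)} (hS : S.Finite) :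
    ∃ c, ∀ v ∈ S, GenericAt A c v := by
  classical
  have hfin := hS.prod A.offDiag.finite_toSet
  have hd := dense_forall_affineMap_ne_zero (S := {p ∈ S ×ˢ (A.offDiag : Set _) |
      p.2.2 p.1 = p.2.1 p.1}) (hfin.subset (sep_subset _ _))
    (h := fun p => ((p.2.2.linear - p.2.1.linear) ∘ₗ rot).toAffineMap -
      AffineMap.const ℝ (ℝ × ℝ) ((p.2.2.linear - p.2.1.linear) (rot p.1))) ?_
  · obtain ⟨c, hc⟩ := hd.nonempty
    refine ⟨c, fun v hv a ha a' ha' hne heq hlin => ?_⟩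
    refine hc (v, a, a') ⟨⟨hv, by simp [ha, ha', hne.symm]⟩, heq⟩ ?_
    simp only [map_sub] at hlin
    simp only [AffineMap.coe_sub, Pi.sub_apply, LinearMap.coe_toAffineMap, LinearMap.comp_apply,
      AffineMap.const_apply, LinearMap.sub_apply]
    linarith
  · rintro ⟨v, a, a'⟩ ⟨⟨-, hp⟩, heq⟩ h
    have hne : a ≠ a' := by simp at hp; tauto
    refine hne (AffineMap.ext_linear (LinearMap.ext fun w => ?_) heq.symm)
    have hw := congrArg (fun k : ℝ × ℝ →ᵃ[ℝ] ℝ => k (v - rot w)) h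
    have hrot : rot (rot w) = -w := by ext <;> simp
    simp only [AffineMap.coe_sub, Pi.sub_apply, LinearMap.coe_toAffineMap, LinearMap.comp_apply,
      AffineMap.const_apply, LinearMap.sub_apply, map_sub, hrot, map_neg, AffineMap.coe_zero,
      Pi.zero_apply] at hw
    linarith

open Classical in
lemma card_cell_inter_le (A B : Finset (ℝ × ℝ →ᵃ[ℝ] ℝ)) (hfin : (corner A ∩ corner B).Finite) :
    {p ∈ A ×ˢ B | (cell A p.1 ∩ cell B p.2).Nonempty}.card ≤
      {a ∈ A | (cell A a).Nonempty}.card + {b ∈ B | (cell B b).Nonempty}.card +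
        hfin.toFinset.card := by
  obtain ⟨c, hc⟩ := exists_genericAt (A ∪ B) hfin
  have hgen (v) (hv : v ∈ corner A ∩ corner B) : v ≠ c ∧ GenericAt A c v ∧ GenericAt B c v := by
    have hA : GenericAt A c v := fun a ha a' ha' => hc v hv a (by simp [ha]) a' (by simp [ha'])
    have hB : GenericAt B c v := fun a ha a' ha' => hc v hv a (by simp [ha]) a' (by simp [ha'])
    refine ⟨?_, hA, hB⟩
    rintro rfl
    obtain ⟨a, ha, a', ha', hne, heq, -⟩ := hv.1
    exact hA a ha a' ha' hne.symm heq.symm (by simp only [sub_self, map_zero])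
  rw [← Finset.card_disjSum, ← Finset.card_disjSum]
  refine Finset.card_le_card_of_forall_subsingleton (fun p => Sum.elim (Sum.elim
    (fun a => p.1 = a ∧ SharesApex c A B p.1 p.2) (fun b => p.2 = b ∧ SharesApex c B A p.2 p.1))
    (fun v => IsLastAt c A B p.1 p.2 v ∨ IsLastAt c B A p.2 p.1 v)) ?_ ?_
  · rintro ⟨a, b⟩ hp
    simp only [Finset.mem_filter, Finset.mem_product] at hp
    obtain ⟨⟨ha, hb⟩, hne⟩ := hp
    rcases sharesApex_or_isLastAt ha hb hgen hne with h | h | ⟨v, hv, h⟩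
    · exact ⟨Sum.inl (Sum.inl a), by simp [ha, hne.mono inter_subset_left], rfl, h⟩
    · exact ⟨Sum.inl (Sum.inr b), by simp [hb, hne.mono inter_subset_right], rfl, h⟩
    · exact ⟨Sum.inr v, by simpa using hv, h⟩
  · rintro q - ⟨a, b⟩ ⟨hp, h⟩ ⟨a', b'⟩ ⟨hp', h'⟩
    simp only [Finset.mem_filter, Finset.mem_product] at hp hp'
    obtain ⟨⟨ha, hb⟩, -⟩ := hp
    obtain ⟨⟨ha', hb'⟩, -⟩ := hp'
    rcases q with (q | q) | v
    · obtain ⟨rfl, h⟩ := h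
      obtain ⟨rfl, h'⟩ := h'
      exact Prod.ext rfl (h.unique hb hb' h')
    · obtain ⟨rfl, h⟩ := h
      obtain ⟨rfl, h'⟩ := h'
      exact Prod.ext (h.unique ha ha' h') rfl
    · rcases h with h | h <;> rcases h' with h' | h'
      · exact Prod.ext_iff.2 (h.unique ha ha' hb hb' h')
      · exact absurd h' (h.not_isLastAt_swap ha ha' hb hb')
      · exact absurd h (h'.not_isLastAt_swap ha' ha hb' hb)
      · exact Prod.ext_iff.2 (h.unique hb hb' ha ha' h').symm

open Classical in
lemma card_cell_le_nregions (hA : A.Nonempty) :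
    {a ∈ A | (cell A a).Nonempty}.card ≤ nregions (corner A) := by
  rw [← Nat.card_eq_finsetCard]
  refine card_le_nregions (C := fun a : {a ∈ A | (cell A a).Nonempty} => cell A a.1)
    (fun a => (Finset.mem_filter.1 a.2).2) (fun a => (convex_cell A a.1).isPreconnected)
    (fun a => isOpen_cell A a.1) (fun a a' hne => disjoint_left.2 fun x hx hx' => ?_) ?_
  · exact hne (Subtype.ext (eq_of_mem_cell (Finset.mem_filter.1 a.2).1
      (Finset.mem_filter.1 a'.2).1 hx hx'))
  · ext x
    simp only [mem_compl_iff, mem_iUnion]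
    constructor
    · intro hx
      obtain ⟨a, ha, hxa⟩ := exists_mem_cell hA hx
      exact ⟨⟨a, Finset.mem_filter.2 ⟨ha, x, hxa⟩⟩, hxa⟩
    · rintro ⟨a, hxa⟩
      exact notMem_corner_of_mem_cell (Finset.mem_filter.1 a.2).1 hxa

end Counting

theorem linear_regions_of_tropical_rational_bound
    (f g : ℝ × ℝ → ℝ) (hf : IsTropSig f) (hg : IsTropSig g)
    (hfin : (Ndiff f ∩ Ndiff g).Finite) :
    nregions (Ndiff (fun x => f x - g x))
      ≤ nregions (Ndiff f) + nregions (Ndiff g) + Nat.card ↥(Ndiff f ∩ Ndiff g) := by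
  classical
  obtain ⟨A, hA, hfA⟩ := hf
  obtain ⟨B, hB, hgB⟩ := hg
  have hsub : Ndiff (fun x => f x - g x) ⊆ Ndiff f ∪ Ndiff g := fun x hx => by
    by_contra h
    simp only [Ndiff, mem_union, mem_ofPred_eq, not_or, not_not] at h
    exact hx (h.1.sub h.2)
  rw [Ndiff_eq_corner hA hfA, Ndiff_eq_corner hB hgB] at *
  have hcells := card_nregions_of_mem_closure
    (ι := {p ∈ A ×ˢ B | (cell A p.1 ∩ cell B p.2).Nonempty})
    (S := Ndiff fun x => f x - g x) (C := fun p => cell A p.1.1 ∩ cell B p.1.2)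
    (fun p => (Finset.mem_filter.1 p.2).2)
    (fun p => ((convex_cell A _).inter (convex_cell B _)).isPreconnected)
    (fun p x hx hN => by
      have hp := Finset.mem_product.1 (Finset.mem_filter.1 p.2).1
      exact (hsub hN).elim (notMem_corner_of_mem_cell hp.1 hx.1)
        (notMem_corner_of_mem_cell hp.2 hx.2))
    (fun x _ => by
      obtain ⟨a, ha, b, hb, hx⟩ := exists_mem_closure_cell_inter hA hB x
      exact ⟨⟨(a, b), Finset.mem_filter.2 ⟨Finset.mem_product.2 ⟨ha, hb⟩,
        closure_nonempty_iff.1 ⟨x, hx⟩⟩⟩, hx⟩)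
  calc
    _ ≤ _ := hcells.2
    _ = _ := Nat.card_eq_finsetCard _
    _ ≤ _ := card_cell_inter_le A B hfin
    _ ≤ _ := by
      rw [Nat.card_coe_set_eq, ncard_eq_toFinset_card _ hfin]
      gcongr
      · exact card_cell_le_nregions hA
      · exact card_cell_le_nregions hB
end

section
/- Let f₁, …, f_m : ℝ² → ℝ (m ≥ 1) be tropical signomials such that for all i < j the set N(fᵢ) ∩ N(fⱼ) is finite and nonempty, and N(fᵢ) ∩ N(fⱼ) ∩ N(f_k) = ∅ for all i < j < k. Then the number of connected components of ℝ² ∖ (N(f₁) ∪ ⋯ ∪ N(f_m)) is at least Σ_{i=1}^m mlen(fᵢ) − (m − 1) + C(m, 2), with equality if and only if N(fᵢ) ∩ N(fⱼ) is a single point for every i < j. -/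
open Set Filter Topology

/-! ### Euler characteristic of combinations of open convex sets and points -/

/-- The graph of the compactly supported Euler characteristic on the group of functions on the
line spanned by indicators of open convex sets and of points. -/
def eulerGraphLine : AddSubgroup ((ℝ → ℤ) × ℤ) :=
  AddSubgroup.closure
    ({q | ∃ I : Set ℝ, IsOpen I ∧ Convex ℝ I ∧ I.Nonempty ∧ q = (I.indicator 1, -1)} ∪
      {q | ∃ p : ℝ, q = (({p} : Set ℝ).indicator 1, 1)})

/-- The graph of the compactly supported Euler characteristic on the group of functions on the
plane spanned by indicators of open convex sets and of points. -/
def eulerGraphPlane : AddSubgroup ((ℝ × ℝ → ℤ) × ℤ) :=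
  AddSubgroup.closure
    ({q | ∃ U : Set (ℝ × ℝ), IsOpen U ∧ Convex ℝ U ∧ U.Nonempty ∧ q = (U.indicator 1, 1)} ∪
      {q | ∃ p : ℝ × ℝ, q = (({p} : Set (ℝ × ℝ)).indicator 1, 1)})

theorem indicator_open_mem_eulerGraphLine {I : Set ℝ} (ho : IsOpen I) (hc : Convex ℝ I)
    (hn : I.Nonempty) : ((I.indicator 1, -1) : (ℝ → ℤ) × ℤ) ∈ eulerGraphLine :=
  AddSubgroup.subset_closure (Or.inl ⟨I, ho, hc, hn, rfl⟩)

theorem indicator_singleton_mem_eulerGraphLine (p : ℝ) :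
    ((({p} : Set ℝ).indicator 1, 1) : (ℝ → ℤ) × ℤ) ∈ eulerGraphLine :=
  AddSubgroup.subset_closure (Or.inr ⟨p, rfl⟩)

theorem indicator_open_mem_eulerGraphPlane {U : Set (ℝ × ℝ)} (ho : IsOpen U) (hc : Convex ℝ U)
    (hn : U.Nonempty) : ((U.indicator 1, 1) : (ℝ × ℝ → ℤ) × ℤ) ∈ eulerGraphPlane :=
  AddSubgroup.subset_closure (Or.inl ⟨U, ho, hc, hn, rfl⟩)

theorem indicator_singleton_mem_eulerGraphPlane (p : ℝ × ℝ) :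
    ((({p} : Set (ℝ × ℝ)).indicator 1, 1) : (ℝ × ℝ → ℤ) × ℤ) ∈ eulerGraphPlane :=
  AddSubgroup.subset_closure (Or.inr ⟨p, rfl⟩)

/-- The Euler characteristic on the line is the total right jump minus the value at `-∞`. -/
theorem exists_jumps_of_mem_eulerGraphLine {q : (ℝ → ℤ) × ℤ} (hq : q ∈ eulerGraphLine) :
    ∃ (d : ℝ →₀ ℤ) (b : ℤ), (∀ t, ∀ᶠ s in 𝓝[>] t, q.1 s = q.1 t - d t) ∧
      (∀ᶠ s in atBot, q.1 s = b) ∧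
      q.2 = Finsupp.linearCombination ℤ (fun _ : ℝ => (1 : ℤ)) d - b := by
  induction hq using AddSubgroup.closure_induction with
  | mem q hq =>
    rcases hq with ⟨I, ho, hc, hn, rfl⟩ | ⟨p, rfl⟩
    · have hoc := hc.ordConnected
      have hin : ∀ t ∈ I, ∀ᶠ s in 𝓝[>] t, s ∈ I := fun t ht =>
        mem_nhdsWithin_of_mem_nhds (ho.mem_nhds ht)
      have hleft : ∀ t ∉ I, (∃ x ∈ I, x < t) → ∀ᶠ s in 𝓝[>] t, s ∉ I := by
        rintro t ht ⟨x, hx, hxt⟩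
        filter_upwards [self_mem_nhdsWithin] with s hs hsI
        exact ht (hoc.out hx hsI ⟨hxt.le, le_of_lt hs⟩)
      by_cases hb : BddBelow I
      · have hglb := isGLB_csInf hn hb
        set a := sInf I
        have ha : a ∉ I := fun h => by
          have hmem : I ∩ Iio a ∈ 𝓝[<] a :=
            inter_mem (mem_nhdsWithin_of_mem_nhds (ho.mem_nhds h)) self_mem_nhdsWithin
          obtain ⟨y, hyI, hy⟩ := Filter.nonempty_of_mem hmem
          exact absurd (hglb.1 hyI) (not_le.2 hy)
        refine ⟨Finsupp.single a (-1), 0, fun t => ?_, ?_, by simp⟩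
        · by_cases ht : t ∈ I
          · have hat : a ≠ t := fun h => ha (h ▸ ht)
            filter_upwards [hin t ht] with s hs
            simp [hs, ht, hat]
          · rcases lt_trichotomy t a with hta | rfl | hta
            · filter_upwards [mem_nhdsWithin_of_mem_nhds (Iio_mem_nhds hta)] with s hs
              have : s ∉ I := fun h => absurd (hglb.1 h) (not_le.2 hs)
              simp [this, ht, hta.ne']
            · obtain ⟨x, hx⟩ := hn
              have hax : a < x := lt_of_le_of_ne (hglb.1 hx) fun h => ha (h ▸ hx)
              filter_upwards [mem_nhdsWithin_of_mem_nhds (Iio_mem_nhds hax),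
                self_mem_nhdsWithin] with s hs hs'
              obtain ⟨y, hy, -, hys⟩ := hglb.exists_between hs'
              have : s ∈ I := hoc.out hy hx ⟨hys.le, le_of_lt hs⟩
              simp [this, ht]
            · obtain ⟨y, hy, -, hys⟩ := hglb.exists_between hta
              filter_upwards [hleft t ht ⟨y, hy, hys⟩] with s hs
              simp [hs, ht, hta.ne]
        · filter_upwards [Iio_mem_atBot a] with s hs
          have : s ∉ I := fun h => absurd (hglb.1 h) (not_le.2 hs)
          simp [this]
      · have hlow : ∀ t, ∃ x ∈ I, x < t := by simpa [not_bddBelow_iff] using hb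
        refine ⟨0, 1, fun t => ?_, ?_, by simp⟩
        · by_cases ht : t ∈ I
          · filter_upwards [hin t ht] with s hs
            simp [hs, ht]
          · filter_upwards [hleft t ht (hlow t)] with s hs
            simp [hs, ht]
        · obtain ⟨x, hx⟩ := hn
          filter_upwards [Iic_mem_atBot x] with s hs
          obtain ⟨y, hy, hys⟩ := hlow s
          have : s ∈ I := hoc.out hy hx ⟨hys.le, hs⟩
          simp [this]
    · refine ⟨Finsupp.single p 1, 0, fun t => ?_, ?_, by simp⟩
      · have hne : ∀ᶠ s in 𝓝[>] t, s ≠ p := by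
          rcases lt_or_ge t p with h | h
          · filter_upwards [mem_nhdsWithin_of_mem_nhds (Iio_mem_nhds h)] with s hs
            exact ne_of_lt hs
          · filter_upwards [self_mem_nhdsWithin] with s hs
            exact ne_of_gt (lt_of_le_of_lt h hs)
        filter_upwards [hne] with s hs
        by_cases ht : t = p
        · subst ht
          simp [hs]
        · simp [hs, ht]
      · filter_upwards [Iio_mem_atBot p] with s hs
        have : s ≠ p := ne_of_lt hs
        simp [this]
  | zero => exact ⟨0, 0, by simp⟩
  | add q r _ _ hq hr =>
    obtain ⟨d, b, h1, h2, h3⟩ := hq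
    obtain ⟨d', b', h1', h2', h3'⟩ := hr
    refine ⟨d + d', b + b', fun t => ?_, ?_, ?_⟩
    · filter_upwards [h1 t, h1' t] with s hs hs'
      simp only [Prod.fst_add, Pi.add_apply, Finsupp.add_apply, hs, hs']
      ring
    · filter_upwards [h2, h2'] with s hs hs'
      simp [hs, hs']
    · rw [Prod.snd_add, h3, h3', map_add]
      ring
  | neg q _ hq =>
    obtain ⟨d, b, h1, h2, h3⟩ := hq
    refine ⟨-d, -b, fun t => ?_, ?_, ?_⟩
    · filter_upwards [h1 t] with s hs
      simp only [Prod.fst_neg, Pi.neg_apply, Finsupp.neg_apply, hs]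
      ring
    · filter_upwards [h2] with s hs
      simp [hs]
    · rw [Prod.snd_neg, h3, map_neg]
      ring

theorem eq_zero_of_mem_eulerGraphLine {n : ℤ} (h : (0, n) ∈ eulerGraphLine) : n = 0 := by
  obtain ⟨d, b, h1, h2, h3⟩ := exists_jumps_of_mem_eulerGraphLine h
  have hd : d = 0 := by
    ext t
    obtain ⟨s, hs⟩ := (h1 t).exists
    simp only [Pi.zero_apply] at hs
    simp only [Finsupp.zero_apply]
    omega
  obtain ⟨s, hs⟩ := h2.exists
  simp only [Pi.zero_apply] at hs
  simpa [hd, ← hs] using h3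

/-- Integrating over the vertical fibres first computes the Euler characteristic. -/
theorem exists_fibre_of_mem_eulerGraphPlane {q : (ℝ × ℝ → ℤ) × ℤ} (hq : q ∈ eulerGraphPlane) :
    ∃ g : ℝ → ℤ, (∀ t, (fun s => q.1 (t, s), g t) ∈ eulerGraphLine) ∧
      (g, q.2) ∈ eulerGraphLine := by
  induction hq using AddSubgroup.closure_induction with
  | mem q hq =>
    rcases hq with ⟨U, ho, hc, hn, rfl⟩ | ⟨p, rfl⟩
    · refine ⟨-(Prod.fst '' U).indicator 1, fun t => ?_, ?_⟩
      · by_cases ht : t ∈ Prod.fst '' U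
        · have hconv : Convex ℝ ((fun s : ℝ => (t, s)) ⁻¹' U) := by
            intro x hx y hy a b ha hb hab
            have := hc hx hy ha hb hab
            simpa [← add_mul, hab] using this
          have hmem := indicator_open_mem_eulerGraphLine
            (ho.preimage (Continuous.prodMk_right t)) hconv
            (by obtain ⟨x, hx, rfl⟩ := ht; exact ⟨x.2, hx⟩)
          rwa [show (-(Prod.fst '' U).indicator (1 : ℝ → ℤ)) t = -1 by
            rw [Pi.neg_apply, indicator_of_mem ht, Pi.one_apply]]
        · convert eulerGraphLine.zero_mem using 1
          ext s
          · have : (t, s) ∉ U := fun h => ht ⟨_, h, rfl⟩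
            simp [this]
          · simp only [Pi.neg_apply, indicator_of_notMem ht, neg_zero, Prod.snd_zero]
      · have hmem := neg_mem (indicator_open_mem_eulerGraphLine (isOpenMap_fst U ho)
          (hc.linear_image (LinearMap.fst ℝ ℝ ℝ)) (hn.image _))
        simpa using hmem
    · refine ⟨({p.1} : Set ℝ).indicator 1, fun t => ?_,
        indicator_singleton_mem_eulerGraphLine p.1⟩
      by_cases ht : t = p.1
      · convert indicator_singleton_mem_eulerGraphLine p.2 using 2
        · ext s
          by_cases hs : s = p.2 <;> simp [indicator, Prod.ext_iff, ht, hs]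
        · simp [ht]
      · convert eulerGraphLine.zero_mem using 1
        ext s <;> simp [indicator, Prod.ext_iff, ht]
  | zero => exact ⟨0, fun t => eulerGraphLine.zero_mem, eulerGraphLine.zero_mem⟩
  | add q r _ _ hq hr =>
    obtain ⟨g, h1, h2⟩ := hq
    obtain ⟨g', h1', h2'⟩ := hr
    exact ⟨g + g', fun t => add_mem (h1 t) (h1' t), add_mem h2 h2'⟩
  | neg q _ hq =>
    obtain ⟨g, h1, h2⟩ := hq
    exact ⟨-g, fun t => neg_mem (h1 t), neg_mem h2⟩

theorem eq_zero_of_mem_eulerGraphPlane {n : ℤ} (h : (0, n) ∈ eulerGraphPlane) : n = 0 := by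
  obtain ⟨g, h1, h2⟩ := exists_fibre_of_mem_eulerGraphPlane h
  have hg : g = 0 := funext fun t => eq_zero_of_mem_eulerGraphLine (h1 t)
  exact eq_zero_of_mem_eulerGraphLine (hg ▸ h2)

theorem eq_of_mem_eulerGraphPlane {h : ℝ × ℝ → ℤ} {k n : ℤ} (hk : (h, k) ∈ eulerGraphPlane)
    (hn : (h, n) ∈ eulerGraphPlane) : k = n := by
  have := sub_mem hk hn
  rw [Prod.mk_sub_mk, sub_self] at this
  exact sub_eq_zero.1 (eq_zero_of_mem_eulerGraphPlane this)

theorem indicator_finite_mem_eulerGraphPlane {P : Set (ℝ × ℝ)} (hP : P.Finite) :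
    ((P.indicator 1, (P.ncard : ℤ)) : (ℝ × ℝ → ℤ) × ℤ) ∈ eulerGraphPlane := by
  induction P, hP using Set.Finite.induction_on with
  | empty =>
    rw [indicator_empty', ncard_empty]
    exact eulerGraphPlane.zero_mem
  | @insert p P hp hP ih =>
    have := add_mem (indicator_singleton_mem_eulerGraphPlane p) ih
    have hind : (insert p P).indicator (1 : ℝ × ℝ → ℤ) =
        ({p} : Set _).indicator 1 + P.indicator 1 :=
      indicator_union_of_disjoint (disjoint_singleton_left.2 hp) 1
    rw [Prod.mk_add_mk, ← hind] at this
    rwa [ncard_insert_of_notMem hp hP, Nat.cast_add, Nat.cast_one, add_comm (P.ncard : ℤ)]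

/-! ### Cells of a tropical signomial -/

section Tropical

variable {E : Type*} [NormedAddCommGroup E] [NormedSpace ℝ E]

theorem hasFDerivAt_affineMap [FiniteDimensional ℝ E] (a : E →ᵃ[ℝ] ℝ) (x : E) :
    HasFDerivAt a (LinearMap.toContinuousLinearMap a.linear) x := by
  have h := (LinearMap.toContinuousLinearMap a.linear).hasFDerivAt (x := x) |>.add_const (a 0)
  refine h.congr_of_eventuallyEq (Eventually.of_forall fun y => ?_)
  simpa using congrFun a.decomp y

/-- The open cell on which `a` strictly dominates the other members of `A`. -/
def dominanceCell (A : Finset (E →ᵃ[ℝ] ℝ)) (a : E →ᵃ[ℝ] ℝ) : Set E :=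
  {x | ∀ b ∈ A, b ≠ a → b x < a x}

theorem isOpen_dominanceCell [FiniteDimensional ℝ E] (A : Finset (E →ᵃ[ℝ] ℝ))
    (a : E →ᵃ[ℝ] ℝ) : IsOpen (dominanceCell A a) := by
  have : dominanceCell A a = ⋂ b ∈ A, {x | b ≠ a → b x < a x} := by
    ext x
    simp [dominanceCell]
  rw [this]
  refine isOpen_biInter_finset fun b _ => ?_
  by_cases h : b = a
  · simp [h]
  · simpa [h] using isOpen_lt b.continuous_of_finiteDimensional a.continuous_of_finiteDimensional

theorem convex_dominanceCell (A : Finset (E →ᵃ[ℝ] ℝ)) (a : E →ᵃ[ℝ] ℝ) :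
    Convex ℝ (dominanceCell A a) := by
  intro x hx y hy s t hs ht hst b hb hba
  rw [Convex.combo_affine_apply hst, Convex.combo_affine_apply hst]
  have h1 := hx b hb hba
  have h2 := hy b hb hba
  simp only [smul_eq_mul]
  rcases hs.eq_or_lt with rfl | hs
  · have : t = 1 := by linarith
    simpa [this] using h2
  · nlinarith [mul_lt_mul_of_pos_left h1 hs, mul_le_mul_of_nonneg_left h2.le ht]

theorem dominanceCell_disjoint {A : Finset (E →ᵃ[ℝ] ℝ)} {a b : E →ᵃ[ℝ] ℝ} {x : E}
    (ha : a ∈ A) (hb : b ∈ A) (hxa : x ∈ dominanceCell A a) (hxb : x ∈ dominanceCell A b) :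
    a = b := by
  by_contra h
  exact lt_asymm (hxa b hb (Ne.symm h)) (hxb a ha h)

theorem compl_Ndiff_eq_iUnion_dominanceCell [FiniteDimensional ℝ E] {f : E → ℝ}
    {A : Finset (E →ᵃ[ℝ] ℝ)} {hA : A.Nonempty} (hf : ∀ x, f x = A.sup' hA (fun a => a x)) :
    (Ndiff f)ᶜ = ⋃ a ∈ A, dominanceCell A a := by
  have hle : ∀ b ∈ A, ∀ x, b x ≤ f x := fun b hb x => hf x ▸ Finset.le_sup' (fun a => a x) hb
  ext x
  simp only [Ndiff, mem_compl_iff, mem_ofPred_eq, not_not, mem_iUnion, exists_prop]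
  constructor
  · intro hx
    have hderiv : ∀ b ∈ A, b x = f x → b.linear = (fderiv ℝ f x : E →ₗ[ℝ] ℝ) := by
      intro b hb hbx
      have hmin : IsLocalMin (f - ⇑b) x := Eventually.of_forall fun y => by
        simpa [hbx] using hle b hb y
      have h0 := hmin.hasFDerivAt_eq_zero (hx.hasFDerivAt.sub (hasFDerivAt_affineMap b x))
      rw [sub_eq_zero.1 h0]
      rfl
    obtain ⟨a, ha, hax⟩ := A.exists_mem_eq_sup' hA (fun a => a x)
    have hax' : a x = f x := (hf x ▸ hax).symm
    refine ⟨a, ha, fun b hb hba => lt_of_le_of_ne (hax' ▸ hle b hb x) fun hbx => hba ?_⟩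
    have hlin : b.linear = a.linear := by
      rw [hderiv b hb (hbx.trans hax'), hderiv a ha hax']
    ext y
    have h1 := b.linearMap_vsub y x
    have h2 := a.linearMap_vsub y x
    rw [hlin, h2] at h1
    simp only [vsub_eq_sub] at h1
    linarith
  · rintro ⟨a, ha, hx⟩
    refine (hasFDerivAt_affineMap a x).differentiableAt.congr_of_eventuallyEq ?_
    filter_upwards [(isOpen_dominanceCell A a).mem_nhds hx] with y hy
    rw [hf y]
    refine le_antisymm (Finset.sup'_le _ _ fun b hb => ?_) (Finset.le_sup' (fun a => a y) ha)
    by_cases h : b = a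
    · rw [h]
    · exact (hy b hb h).le

theorem IsTropSig.exists_minimal {f : E → ℝ} (h : IsTropSig f) :
    ∃ (A : Finset (E →ᵃ[ℝ] ℝ)) (hA : A.Nonempty), A.card = mlen f ∧
      (∀ x, f x = A.sup' hA (fun a => a x)) ∧ ∀ a ∈ A, (dominanceCell A a).Nonempty := by
  classical
  obtain ⟨A₀, hA₀, h₀⟩ := h
  obtain ⟨A, hA, hcard, hf⟩ := Nat.sInf_mem (s := {k | ∃ (A : Finset (E →ᵃ[ℝ] ℝ))
    (h : A.Nonempty), A.card = k ∧ ∀ x, f x = A.sup' h (fun a => a x)}) ⟨_, A₀, hA₀, rfl, h₀⟩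
  refine ⟨A, hA, hcard, hf, fun a ha => ?_⟩
  by_contra hemp
  have hdom : ∀ x, ∃ b ∈ A.erase a, a x ≤ b x := by
    intro x
    by_contra! hx
    exact hemp ⟨x, fun b hb hba => hx b (Finset.mem_erase.2 ⟨hba, hb⟩)⟩
  have hne : (A.erase a).Nonempty := (hdom 0).imp fun _ h => h.1
  have hle : mlen f ≤ (A.erase a).card := by
    refine Nat.sInf_le ⟨A.erase a, hne, rfl, fun x => ?_⟩
    rw [hf x]
    refine le_antisymm (Finset.sup'_le _ _ fun b hb => ?_)
      (Finset.sup'_mono _ (Finset.erase_subset a A) hne)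
    by_cases hba : b = a
    · obtain ⟨c, hc, hac⟩ := hdom x
      rw [hba]
      exact hac.trans (Finset.le_sup' (fun a => a x) hc)
    · exact Finset.le_sup' (fun a => a x) (Finset.mem_erase.2 ⟨hba, hb⟩)
  have := Finset.card_erase_lt_of_mem ha
  have : A.card = mlen f := hcard
  omega

theorem IsTropSig.exists_affine_minorant {f : E → ℝ} (h : IsTropSig f) (x : E) :
    ∃ a : E →ᵃ[ℝ] ℝ, a x = f x ∧ ∀ y, a y ≤ f y := by
  obtain ⟨A, hA, hf⟩ := h
  obtain ⟨a, ha, hax⟩ := A.exists_mem_eq_sup' hA (fun a => a x)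
  exact ⟨a, (hf x ▸ hax).symm, fun y => hf y ▸ Finset.le_sup' (fun a => a y) ha⟩

theorem IsTropSig.zero : IsTropSig (0 : E → ℝ) := ⟨{0}, by simp, by simp⟩

theorem IsTropSig.add {f g : E → ℝ} (hf : IsTropSig f) (hg : IsTropSig g) :
    IsTropSig (f + g) := by
  classical
  obtain ⟨A, hA, hf⟩ := hf
  obtain ⟨B, hB, hg⟩ := hg
  refine ⟨Finset.image₂ (· + ·) A B, hA.image₂ hB, fun x => ?_⟩
  rw [Pi.add_apply, hf, hg]
  apply le_antisymm
  · obtain ⟨a, ha, hax⟩ := A.exists_mem_eq_sup' hA (fun a => a x)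
    obtain ⟨b, hb, hbx⟩ := B.exists_mem_eq_sup' hB (fun a => a x)
    rw [hax, hbx]
    exact Finset.le_sup' (fun a : E →ᵃ[ℝ] ℝ => a x)
      (Finset.mem_image₂_of_mem (f := (· + ·)) ha hb)
  · refine Finset.sup'_le _ _ fun c hc => ?_
    obtain ⟨a, ha, b, hb, rfl⟩ := Finset.mem_image₂.1 hc
    exact add_le_add (Finset.le_sup' (fun a => a x) ha) (Finset.le_sup' (fun a => a x) hb)

theorem IsTropSig.differentiableAt_of_add [FiniteDimensional ℝ E] {f g : E → ℝ}
    (hf : IsTropSig f) (hg : IsTropSig g) {x : E} (h : DifferentiableAt ℝ (f + g) x) :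
    DifferentiableAt ℝ f x := by
  obtain ⟨a, hax, ha⟩ := hf.exists_affine_minorant x
  obtain ⟨b, hbx, hb⟩ := hg.exists_affine_minorant x
  have hab := (hasFDerivAt_affineMap a x).add (hasFDerivAt_affineMap b x)
  have hmin : IsLocalMin ((f + g) - (⇑a + ⇑b)) x := Eventually.of_forall fun y => by
    simpa [hax, hbx] using add_le_add (ha y) (hb y)
  have hsub := h.hasFDerivAt.sub hab
  rw [hmin.hasFDerivAt_eq_zero hsub] at hsub
  have hfa : HasFDerivAt (f - ⇑a) (0 : E →L[ℝ] ℝ) x := by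
    refine .of_isLittleO (Asymptotics.IsBigO.trans_isLittleO ?_ hsub.isLittleO)
    refine Asymptotics.IsBigO.of_bound 1 (Eventually.of_forall fun y => ?_)
    have h1 := ha y
    have h2 := hb y
    simp only [Pi.sub_apply, Pi.add_apply, hax, hbx, sub_self, zero_apply,
      sub_zero, one_mul, Real.norm_eq_abs]
    rw [abs_of_nonneg (by linarith), abs_of_nonneg (by linarith)]
    linarith
  simpa using (hfa.add (hasFDerivAt_affineMap a x)).differentiableAt

theorem IsTropSig.Ndiff_add [FiniteDimensional ℝ E] {f g : E → ℝ} (hf : IsTropSig f)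
    (hg : IsTropSig g) : Ndiff (f + g) = Ndiff f ∪ Ndiff g := by
  ext x
  simp only [Ndiff, mem_ofPred_eq, mem_union, ← not_and_or, not_iff_not]
  exact ⟨fun h => ⟨hf.differentiableAt_of_add hg h,
    hg.differentiableAt_of_add hf (by rwa [add_comm])⟩, fun h => h.1.add h.2⟩

theorem isTropSig_sum_and_Ndiff_sum [FiniteDimensional ℝ E] {ι : Type*} (s : Finset ι)
    {f : ι → E → ℝ} (hf : ∀ i, IsTropSig (f i)) :
    IsTropSig (∑ i ∈ s, f i) ∧ Ndiff (∑ i ∈ s, f i) = ⋃ i ∈ s, Ndiff (f i) := by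
  classical
  induction s using Finset.induction_on with
  | empty =>
    refine ⟨by simpa using IsTropSig.zero, ?_⟩
    ext x
    simp [Ndiff]
  | insert i s hi ih =>
    rw [Finset.sum_insert hi, Finset.set_biUnion_insert, ← ih.2]
    exact ⟨(hf i).add ih.1, (hf i).Ndiff_add ih.1⟩

end Tropical

/-! ### Counting regions -/

theorem card_connectedComponents_of_iUnion {X ι : Type*} [TopologicalSpace X] {S : Set X}
    {A : Finset ι} {U : ι → Set X} (hS : S = ⋃ a ∈ A, U a) (ho : ∀ a ∈ A, IsOpen (U a))
    (hc : ∀ a ∈ A, IsPreconnected (U a)) (hn : ∀ a ∈ A, (U a).Nonempty)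
    (hd : ∀ a ∈ A, ∀ b ∈ A, ∀ x, x ∈ U a → x ∈ U b → a = b) :
    Nat.card (ConnectedComponents S) = A.card := by
  have hex : ∀ x : S, ∃ a : A, (x : X) ∈ U a := by
    intro x
    have hx := x.2
    simp only [hS, mem_iUnion] at hx
    obtain ⟨a, ha, hx⟩ := hx
    exact ⟨⟨a, ha⟩, hx⟩
  choose φ hφ using hex
  let _ : TopologicalSpace A := ⊥
  have : DiscreteTopology A := ⟨rfl⟩
  have hφ' : ∀ (x : S) (a : A), (x : X) ∈ U a → φ x = a := fun x a hx =>
    Subtype.ext (hd _ (φ x).2 _ a.2 x (hφ x) hx)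
  have hcont : Continuous φ := by
    refine continuous_discrete_rng.2 fun a => ?_
    have : φ ⁻¹' {a} = Subtype.val ⁻¹' U a := by
      ext x
      exact ⟨fun h => (show φ x = a from h) ▸ hφ x, hφ' x a⟩
    rw [this]
    exact (ho a a.2).preimage continuous_subtype_val
  have hbij : Function.Bijective hcont.connectedComponentsLift := by
    constructor
    · intro p q
      obtain ⟨x, rfl⟩ := ConnectedComponents.surjective_coe p
      obtain ⟨y, rfl⟩ := ConnectedComponents.surjective_coe q
      intro hxy
      simp only [Continuous.connectedComponentsLift_apply_coe] at hxy
      have hsub : U (φ x) ⊆ S := hS ▸ subset_biUnion_of_mem (u := U) (φ x).2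
      have hpre : IsPreconnected (Subtype.val ⁻¹' U (φ x) : Set S) := by
        refine IsInducing.subtypeVal.isPreconnected_image.1 ?_
        rw [Subtype.image_preimage_coe, inter_eq_right.2 hsub]
        exact hc _ (φ x).2
      refine ConnectedComponents.coe_eq_coe'.2 (hpre.subset_connectedComponent ?_ (hφ x))
      exact hxy ▸ hφ y
    · intro a
      obtain ⟨x, hx⟩ := hn a a.2
      have hxS : x ∈ S := hS ▸ mem_biUnion (t := U) (s := {a | a ∈ A}) a.2 hx
      exact ⟨((⟨x, hxS⟩ : S) : ConnectedComponents S), by simpa using hφ' ⟨x, hxS⟩ a hx⟩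
  rw [Nat.card_congr (Equiv.ofBijective _ hbij), Nat.card_eq_fintype_card, Fintype.card_coe]

theorem IsTropSig.nregions_Ndiff {f : ℝ × ℝ → ℝ} (hf : IsTropSig f) :
    nregions (Ndiff f) = mlen f := by
  obtain ⟨A, hA, hcard, hf, hn⟩ := hf.exists_minimal
  rw [← hcard]
  exact card_connectedComponents_of_iUnion (compl_Ndiff_eq_iUnion_dominanceCell hf)
    (fun a _ => isOpen_dominanceCell A a) (fun a _ => (convex_dominanceCell A a).isPreconnected)
    hn fun a ha b hb x hxa hxb => dominanceCell_disjoint ha hb hxa hxb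

theorem IsTropSig.indicator_Ndiff_mem_eulerGraphPlane {f : ℝ × ℝ → ℝ} (hf : IsTropSig f) :
    (((Ndiff f).indicator 1, 1 - (mlen f : ℤ)) : (ℝ × ℝ → ℤ) × ℤ) ∈ eulerGraphPlane := by
  obtain ⟨A, hA, hcard, hf, hn⟩ := hf.exists_minimal
  have hcells := sum_mem fun a ha => indicator_open_mem_eulerGraphPlane
    (isOpen_dominanceCell A a) (convex_dominanceCell A a) (hn a ha)
  have huniv := indicator_open_mem_eulerGraphPlane isOpen_univ convex_univ univ_nonempty
  convert sub_mem huniv hcells using 1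
  refine Prod.ext ?_ (by simp [Prod.snd_sum, hcard])
  have hsum : (⋃ a ∈ A, dominanceCell A a).indicator (1 : ℝ × ℝ → ℤ) =
      ∑ a ∈ A, (dominanceCell A a).indicator 1 := by
    rw [Finset.indicator_biUnion]
    · ext x
      simp
    · intro a ha b hb hab
      exact disjoint_left.2 fun x hxa hxb => hab (dominanceCell_disjoint ha hb hxa hxb)
  rw [Prod.fst_sub, Prod.fst_sum, ← hsum, ← compl_Ndiff_eq_iUnion_dominanceCell hf,
    indicator_compl]
  simp

/-- Inclusion-exclusion for families without triple intersections. -/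
theorem indicator_iUnion_eq_sum_sub_sum {ι X : Type*} [Fintype ι] [LinearOrder ι]
    {N : ι → Set X} (h : ∀ i j k : ι, i < j → j < k → N i ∩ N j ∩ N k = ∅) :
    (⋃ i, N i).indicator (1 : X → ℤ) = ∑ i, (N i).indicator 1 -
      ∑ p ∈ (Finset.univ ×ˢ Finset.univ).filter (fun p : ι × ι => p.1 < p.2),
        (N p.1 ∩ N p.2).indicator 1 := by
  classical
  ext x
  set s : Finset ι := Finset.univ.filter fun i => x ∈ N i with hs
  have hone : ∑ i, (N i).indicator (1 : X → ℤ) x = s.card := by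
    simp [indicator_apply, hs]
  have htwo : ∑ p ∈ (Finset.univ ×ˢ Finset.univ).filter (fun p : ι × ι => p.1 < p.2),
      (N p.1 ∩ N p.2).indicator (1 : X → ℤ) x = s.card.choose 2 := by
    rw [← Finset.card_product_filter_lt (s := s)]
    simp only [indicator_apply, Pi.one_apply, Finset.sum_boole, Finset.filter_filter]
    congr 2
    ext p
    simp [hs, and_comm]
  have hcard : s.card ≤ 2 := by
    by_contra! hlt
    let e := s.orderEmbOfFin rfl
    have hmem : ∀ i, x ∈ N (e i) := fun i =>
      (Finset.mem_filter.1 (s.orderEmbOfFin_mem rfl i)).2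
    have hemp := h (e ⟨0, by omega⟩) (e ⟨1, by omega⟩) (e ⟨2, by omega⟩)
      (e.strictMono (by simp)) (e.strictMono (by simp))
    exact (hemp ▸ ⟨⟨hmem _, hmem _⟩, hmem _⟩ : x ∈ (∅ : Set X))
  have hunion : (⋃ i, N i).indicator (1 : X → ℤ) x = if s.card = 0 then 0 else 1 := by
    by_cases hx : x ∈ ⋃ i, N i
    · have : s.card ≠ 0 := by
        obtain ⟨i, hi⟩ := mem_iUnion.1 hx
        exact Finset.card_ne_zero_of_mem (Finset.mem_filter.2 ⟨Finset.mem_univ i, hi⟩)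
      rw [indicator_of_mem hx, if_neg this, Pi.one_apply]
    · have : s.card = 0 := by
        simpa [hs, Finset.filter_eq_empty_iff] using hx
      rw [indicator_of_notMem hx, if_pos this]
  rw [Pi.sub_apply, Finset.sum_apply, Finset.sum_apply, hone, htwo, hunion]
  interval_cases s.card <;> simp

/-- The exact number of regions of an arrangement of tropical curves without triple points. -/
theorem nregions_iUnion_Ndiff {m : ℕ} {f : Fin m → ℝ × ℝ → ℝ} (hts : ∀ i, IsTropSig (f i))
    (hfin : ∀ i j : Fin m, i < j → (Ndiff (f i) ∩ Ndiff (f j)).Finite)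
    (htriple : ∀ i j k : Fin m, i < j → j < k →
      Ndiff (f i) ∩ Ndiff (f j) ∩ Ndiff (f k) = ∅) :
    nregions (⋃ i, Ndiff (f i)) + m = 1 + ∑ i, mlen (f i) +
      ∑ p ∈ (Finset.univ ×ˢ Finset.univ).filter (fun p : Fin m × Fin m => p.1 < p.2),
        (Ndiff (f p.1) ∩ Ndiff (f p.2)).ncard := by
  obtain ⟨hF, hN⟩ := isTropSig_sum_and_Ndiff_sum Finset.univ hts
  simp only [Finset.mem_univ, iUnion_true] at hN
  have hunion := hF.indicator_Ndiff_mem_eulerGraphPlane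
  rw [← hF.nregions_Ndiff, hN] at hunion
  have hsum := sub_mem (sum_mem fun i (_ : i ∈ Finset.univ) =>
      (hts i).indicator_Ndiff_mem_eulerGraphPlane)
    (sum_mem fun p (hp : p ∈ (Finset.univ ×ˢ Finset.univ).filter
      (fun p : Fin m × Fin m => p.1 < p.2)) =>
      indicator_finite_mem_eulerGraphPlane (hfin p.1 p.2 (Finset.mem_filter.1 hp).2))
  rw [← prod_mk_sum, ← prod_mk_sum, Prod.mk_sub_mk,
    ← indicator_iUnion_eq_sum_sub_sum htriple] at hsum
  have key := eq_of_mem_eulerGraphPlane hunion hsum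
  rw [Finset.sum_sub_distrib] at key
  simp only [Finset.sum_const, Finset.card_univ, Fintype.card_fin, nsmul_eq_mul, mul_one] at key
  zify
  linarith

theorem region_lower_bound_tropical_curves
    (m : ℕ) (hm : 1 ≤ m) (f : Fin m → ℝ × ℝ → ℝ)
    (hts : ∀ i, IsTropSig (f i))
    (hfin : ∀ i j : Fin m, i < j → (Ndiff (f i) ∩ Ndiff (f j)).Finite)
    (hne : ∀ i j : Fin m, i < j → (Ndiff (f i) ∩ Ndiff (f j)).Nonempty)
    (htriple : ∀ i j k : Fin m, i < j → j < k →
      Ndiff (f i) ∩ Ndiff (f j) ∩ Ndiff (f k) = ∅) :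
    ((∑ i, mlen (f i)) + m.choose 2 ≤ nregions (⋃ i, Ndiff (f i)) + (m - 1)) ∧
    ((∑ i, mlen (f i)) + m.choose 2 = nregions (⋃ i, Ndiff (f i)) + (m - 1) ↔
      ∀ i j : Fin m, i < j → ∃ p, Ndiff (f i) ∩ Ndiff (f j) = {p}) := by
  have hregions := nregions_iUnion_Ndiff hts hfin htriple
  have hchoose := Finset.card_product_filter_lt (s := (Finset.univ : Finset (Fin m)))
  rw [Finset.card_univ, Fintype.card_fin, Finset.card_eq_sum_ones] at hchoose
  set P := (Finset.univ ×ˢ Finset.univ).filter (fun p : Fin m × Fin m => p.1 < p.2) with hP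
  have hle : ∀ p ∈ P, 1 ≤ (Ndiff (f p.1) ∩ Ndiff (f p.2)).ncard := fun p hp =>
    have hlt := (Finset.mem_filter.1 hp).2
    (ncard_pos (hfin _ _ hlt)).2 (hne _ _ hlt)
  have hsum := Finset.sum_le_sum hle
  have hiff := Finset.sum_eq_sum_iff_of_le hle
  refine ⟨by omega, ?_⟩
  trans ∑ p ∈ P, 1 = ∑ p ∈ P, (Ndiff (f p.1) ∩ Ndiff (f p.2)).ncard
  · omega
  · rw [hiff]
    constructor
    · intro h i j hij
      exact ncard_eq_one.1 (h (i, j) (by simpa [hP] using hij)).symm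
    · intro h p hp
      exact (ncard_eq_one.2 (h p.1 p.2 (Finset.mem_filter.1 hp).2)).symm
end
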